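/- Let χ be an order type in general position on a finite set V with |V| = n ≥ 4, and let u, v, w be pairwise distinct non-hull elements of χ. Suppose that for every hull element h′, exactly one of u and w occurs before v in the hull surrounding sequence of h′, and suppose h is a hull element such that u occurs before v and v occurs before w in a hull surrounding sequence of h. Let w_1, …, w_{n−1} be a cyclic shift, starting at w_1 = h, of an internal surrounding sequence of u. Then χ(u, v, w) = −1 if and only if v occurs before w in the sequence w_1, …, w_{n−1}. -/

import Mathlib

/-- The 2×2 determinant of two vectors in `ℝ²`. -/
def det2 (x y : ℝ × ℝ) : ℝ := x.1 * y.2 - x.2 * y.1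

/-- An order type in general position on `V`: values in `{-1,+1}` on pairwise distinct
triples and `0` otherwise, alternating, and satisfying the GP axiom. -/
def IsOrderType {V : Type*} (χ : V → V → V → ℤ) : Prop :=
  (∀ a b c : V, a ≠ b → a ≠ c → b ≠ c → χ a b c = 1 ∨ χ a b c = -1) ∧
  (∀ a b c : V, a = b ∨ a = c ∨ b = c → χ a b c = 0) ∧
  (∀ a b c : V, χ b a c = -χ a b c) ∧
  (∀ a b c : V, χ a c b = -χ a b c) ∧
  (∀ x a b c d : V, x ≠ a → x ≠ b → x ≠ c → x ≠ d → a ≠ b → a ≠ c → a ≠ d →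
    b ≠ c → b ≠ d → c ≠ d →
    ((χ x a b * χ x c d = -1 ∨ -(χ x a c * χ x b d) = -1 ∨ χ x a d * χ x b c = -1) ∧
     (χ x a b * χ x c d = 1 ∨ -(χ x a c * χ x b d) = 1 ∨ χ x a d * χ x b c = 1)))

/-- A convex hull sequence of `χ`: a cyclic sequence `h 0, …, h (t-1)` (`t ≥ 3`) of distinct
elements with `χ (h i) (h (i+1)) v = 1` for every `i` (mod `t`) and every other `v`. -/
def IsConvexHullSeq {V : Type*} (χ : V → V → V → ℤ) (t : ℕ) (h : ZMod t → V) : Prop :=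
  3 ≤ t ∧ Function.Injective h ∧
  ∀ i : ZMod t, ∀ v : V, v ≠ h i → v ≠ h (i + 1) → χ (h i) (h (i + 1)) v = 1

/-- A hull element: an element appearing in some convex hull sequence of `χ`. -/
def IsHullElement {V : Type*} (χ : V → V → V → ℤ) (x : V) : Prop :=
  ∃ (t : ℕ) (h : ZMod t → V), IsConvexHullSeq χ t h ∧ x ∈ Set.range h

/-- A hull surrounding sequence of a hull element `h`: an enumeration of `V \ {h}` with
`χ v_j h v_{j+1} = 1` for consecutive entries. -/
def IsHullSurroundSeq {V : Type*} (χ : V → V → V → ℤ) (h : V) (s : List V) : Prop :=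
  s.Nodup ∧ (∀ x : V, x ∈ s ↔ x ≠ h) ∧ s.Chain' (fun a b => χ a h b = 1)

/-- An internal surrounding sequence of a non-hull element `v`: an enumeration of `V \ {v}`
which is cyclically `χ`-increasing around `v`, and with exactly one sign change of
`χ v₁ v ·` along the sequence. -/
def IsInternalSurroundSeq {V : Type*} (χ : V → V → V → ℤ) (v : V) (s : List V) : Prop :=
  s.Nodup ∧ (∀ x : V, x ∈ s ↔ x ≠ v) ∧
  s.Chain' (fun a b => χ a v b = 1) ∧
  (∀ a b : V, s.getLast? = some a → s.head? = some b → χ a v b = 1) ∧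
  ∃! p : ℕ, 0 < p ∧ p + 1 < s.length ∧
    (∀ j : ℕ, 0 < j → j ≤ p → χ (s.getD 0 v) v (s.getD j v) = 1) ∧
    (∀ j : ℕ, p < j → j < s.length → χ (s.getD 0 v) v (s.getD j v) = -1)

/-- The cyclic triangle `h₁, h₂, h₃` as a map `ZMod 3 → V`. -/
def tripleHull {V : Type*} (h₁ h₂ h₃ : V) : ZMod 3 → V :=
  fun i => if i = 0 then h₁ else if i = 1 then h₂ else h₃

/-- The wheel graph `W_v` on `V` determined by the surrounding sequence `s` of `v`:
the cycle through consecutive entries of `s` (taken cyclically) plus all spokes from `v`. -/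
def wheelGraph {V : Type*} (v : V) (s : List V) : SimpleGraph V :=
  SimpleGraph.fromRel (fun a b =>
    (a = v ∧ b ∈ s) ∨
    (∃ i : ℕ, i + 1 < s.length ∧ s.getD i v = a ∧ s.getD (i + 1) v = b) ∨
    (s.getLast? = some a ∧ s.head? = some b))

/-- The vertex set of `T_v`: the four frame vertices `t₁,…,t₄` together with three copies
of the non-hull elements. -/
def TVert (V : Type*) (h₁ h₂ h₃ : V) : Type _ :=
  Fin 4 ⊕ ({x : V // x ≠ h₁ ∧ x ≠ h₂ ∧ x ≠ h₃} × Fin 3)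

/-- The embedding of copy `i` of `V` into the vertex set of `T_v`: a non-hull element `u`
goes to `(u, i)`; the hull `h₁,h₂,h₃` is mapped (with `t₁,t₂,t₃,t₄` being `0,1,2,3`) to
`t₁,t₄,t₃` for copy `0`, to `t₂,t₄,t₁` for copy `1`, and to `t₃,t₄,t₂` for copy `2`. -/
def copyMap {V : Type*} [DecidableEq V] (h₁ h₂ h₃ : V) (i : Fin 3) (u : V) :
    TVert V h₁ h₂ h₃ :=
  if hu : u ≠ h₁ ∧ u ≠ h₂ ∧ u ≠ h₃ then Sum.inr (⟨u, hu⟩, i)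
  else if u = h₂ then Sum.inl 3
  else if u = h₁ then Sum.inl (Fin.castLE (by norm_num) i)
  else Sum.inl (Fin.castLE (by norm_num) (i + 2))

/-- The graph `T_v`: the complete frame on `t₁,…,t₄` together with the images of the three
copies of the wheel graph `W_v` under the copy maps. -/
def TGraph {V : Type*} [DecidableEq V] (h₁ h₂ h₃ : V) (v : V) (s : List V) :
    SimpleGraph (TVert V h₁ h₂ h₃) :=
  SimpleGraph.fromRel (fun a b =>
    (∃ x y : Fin 4, a = Sum.inl x ∧ b = Sum.inl y) ∨
    (∃ (i : Fin 3) (u w : V), (wheelGraph v s).Adj u w ∧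
      a = copyMap h₁ h₂ h₃ i u ∧ b = copyMap h₁ h₂ h₃ i w))

/-- `φ` induces a plane straight-line drawing of `G`: `φ` is injective, any two distinct
edges intersect exactly in the images of their common endpoints, and no vertex image lies
on the closed segment of an edge not containing that vertex. -/
def IsPlaneDrawing {U : Type*} (G : SimpleGraph U) (φ : U → ℝ × ℝ) : Prop :=
  Function.Injective φ ∧
  (∀ a b c d : U, G.Adj a b → G.Adj c d → s(a, b) ≠ s(c, d) →
    segment ℝ (φ a) (φ b) ∩ segment ℝ (φ c) (φ d) =
      φ '' (({a, b} : Set U) ∩ {c, d})) ∧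
  (∀ a b x : U, G.Adj a b → x ≠ a → x ≠ b → φ x ∉ segment ℝ (φ a) (φ b))

/-- `f` realizes the order type `χ` by points in the plane. -/
def Realizes {V : Type*} (χ : V → V → V → ℤ) (f : V → ℝ × ℝ) : Prop :=
  Function.Injective f ∧
  ∀ a b c : V, a ≠ b → a ≠ c → b ≠ c →
    χ a b c = (SignType.sign (det2 (f c - f a) (f b - f a)) : ℤ)

/-- `G` is 3-connected: removing any at most two vertices leaves a connected graph. -/
def ThreeConnected {U : Type*} (G : SimpleGraph U) : Prop :=
  ∀ S : Set U, S.ncard ≤ 2 → (G.induce Sᶜ).Connected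

/-- The wheel graph with rim of length `n`: rim vertices `Fin n` consecutively adjacent
(mod `n`) and a hub adjacent to every rim vertex. -/
def wheel (n : ℕ) : SimpleGraph (Fin n ⊕ Unit) :=
  SimpleGraph.fromRel (fun a b =>
    (∃ i j : Fin n, (j : ℕ) = ((i : ℕ) + 1) % n ∧ a = Sum.inl i ∧ b = Sum.inl j) ∨
    (∃ i : Fin n, a = Sum.inr () ∧ b = Sum.inl i))

/-- No three points of `P` are collinear. -/
def NoThreeCollinear (P : Set (ℝ × ℝ)) : Prop :=
  ∀ a ∈ P, ∀ b ∈ P, ∀ c ∈ P, a ≠ b → a ≠ c → b ≠ c → det2 (b - a) (c - a) ≠ 0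

/-- `q` is a counterclockwise radial order of `P \ {p}` around `p`. -/
def CCWRadialOrder (P : Set (ℝ × ℝ)) (p : ℝ × ℝ) (q : List (ℝ × ℝ)) : Prop :=
  q.Nodup ∧ (∀ x : ℝ × ℝ, x ∈ q ↔ x ∈ P \ {p}) ∧
  ∀ j : ℕ, j < q.length →
    0 < det2 (q.getD j p - p) (q.getD ((j + 1) % q.length) p - p) ∧
    ∀ r ∈ P, r ≠ p → r ≠ q.getD j p → r ≠ q.getD ((j + 1) % q.length) p →
      ¬(0 < det2 (q.getD j p - p) (r - p) ∧
        0 < det2 (r - p) (q.getD ((j + 1) % q.length) p - p))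

/-- The edges (as ordered pairs of endpoints) of the straight-line drawing of the wheel
with hub `p` and rim cycle `q`: the spokes `(p, qⱼ)` and the rim edges `(qⱼ, q_{j+1})`,
indices mod the length of `q`. -/
def wheelEdgePairs (p : ℝ × ℝ) (q : List (ℝ × ℝ)) : Set ((ℝ × ℝ) × (ℝ × ℝ)) :=
  {e | ∃ j : ℕ, j < q.length ∧
    (e = (p, q.getD j p) ∨ e = (q.getD j p, q.getD ((j + 1) % q.length) p))}

/-- The straight-line drawing of the wheel with hub `p` and rim cycle `q` is plane: any two
distinct segments among the spokes and rim edges intersect exactly in their common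
endpoints. -/
def WheelDrawingPlane (p : ℝ × ℝ) (q : List (ℝ × ℝ)) : Prop :=
  ∀ e₁ ∈ wheelEdgePairs p q, ∀ e₂ ∈ wheelEdgePairs p q,
    s(e₁.1, e₁.2) ≠ s(e₂.1, e₂.2) →
    segment ℝ e₁.1 e₁.2 ∩ segment ℝ e₂.1 e₂.2 =
      ({e₁.1, e₁.2} : Set (ℝ × ℝ)) ∩ {e₂.1, e₂.2}

section OrderTypeRadial

variable {V : Type*} {χ : V → V → V → ℤ}

theorem IsOrderType.ne_of_eq_one (hχ : IsOrderType χ) {a b c : V} (h : χ a b c = 1) :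
    a ≠ b ∧ a ≠ c ∧ b ≠ c := by
  have := hχ.2.1 a b c
  grind

theorem IsOrderType.swap_outer (hχ : IsOrderType χ) (a b c : V) : χ c b a = -χ a b c := by
  rw [hχ.2.2.1 b c a, hχ.2.2.2.1 b a c, hχ.2.2.1 a b c, neg_neg]

/-- The three-term Grassmann–Plücker axiom written for the radial signs `χ · x ·`. -/
theorem IsOrderType.radial_gp (hχ : IsOrderType χ) {x a b c d : V}
    (xa : x ≠ a) (xb : x ≠ b) (xc : x ≠ c) (xd : x ≠ d) (ab : a ≠ b) (ac : a ≠ c)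
    (ad : a ≠ d) (bc : b ≠ c) (bd : b ≠ d) (cd : c ≠ d) :
    (χ a x b * χ c x d = -1 ∨ -(χ a x c * χ b x d) = -1 ∨ χ a x d * χ b x c = -1) ∧
    (χ a x b * χ c x d = 1 ∨ -(χ a x c * χ b x d) = 1 ∨ χ a x d * χ b x c = 1) := by
  have key := hχ.2.2.2.2 x a b c d xa xb xc xd ab ac ad bc bd cd
  simpa only [hχ.2.2.1 x, neg_mul_neg] using key

theorem IsOrderType.radial_trans (hχ : IsOrderType χ) {x p a b c : V} {ε : ℤ}
    (hε : ε = 1 ∨ ε = -1) (ha : χ p x a = ε) (hb : χ p x b = ε) (hc : χ p x c = ε)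
    (hab : χ a x b = 1) (hbc : χ b x c = 1) : χ a x c = 1 := by
  obtain ⟨ax, ab, xb⟩ := hχ.ne_of_eq_one hab
  obtain ⟨-, bc, xc⟩ := hχ.ne_of_eq_one hbc
  have zero := hχ.2.1 p x
  have ac : a ≠ c := by
    rintro rfl
    have := hχ.swap_outer a x b
    omega
  have gp := hχ.radial_gp (x := x) (a := p) (b := a) (c := b) (d := c)
    (by grind) ax.symm xb xc (by grind) (by grind) (by grind) ab ac bc
  rw [ha, hb, hc, hab, hbc] at gp
  rcases hχ.1 a x c ax ac xc with h | h
  · exact h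
  · rw [h] at gp
    rcases hε with rfl | rfl <;> omega

/-- A hull element `h` is preceded by some `p` having all other elements on one side of `p h`. -/
theorem IsHullElement.exists_pred {h : V} (hh : IsHullElement χ h) :
    ∃ p, ∀ v, v ≠ p → v ≠ h → χ p h v = 1 := by
  obtain ⟨t, f, ⟨-, -, hf⟩, i, rfl⟩ := hh
  refine ⟨f (i - 1), fun v hp hv => ?_⟩
  have := hf (i - 1) v hp
  rw [sub_add_cancel] at this
  exact this hv

/-- The radial order around a hull element is transitive. -/
theorem IsHullElement.radial_trans (hχ : IsOrderType χ) {h a b c : V} (hh : IsHullElement χ h)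
    (hab : χ a h b = 1) (hbc : χ b h c = 1) : χ a h c = 1 := by
  obtain ⟨p, hp⟩ := hh.exists_pred
  obtain ⟨ah, ab, hb⟩ := hχ.ne_of_eq_one hab
  obtain ⟨-, bc, hc⟩ := hχ.ne_of_eq_one hbc
  have not_to_p : ∀ y, χ y h p ≠ 1 := fun y hy => by
    obtain ⟨yh, yp, -⟩ := hχ.ne_of_eq_one hy
    have := hχ.swap_outer p h y
    have := hp y yp yh
    omega
  have hbp : b ≠ p := fun e => not_to_p a (e ▸ hab)
  have hcp : c ≠ p := fun e => not_to_p b (e ▸ hbc)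
  by_cases hap : a = p
  · exact hap ▸ hp c hcp hc.symm
  · exact hχ.radial_trans (Or.inl rfl) (hp a hap ah) (hp b hbp hb.symm) (hp c hcp hc.symm)
      hab hbc

theorem IsHullSurroundSeq.pairwise (hχ : IsOrderType χ) {h : V} (hh : IsHullElement χ h)
    {s : List V} (hs : IsHullSurroundSeq χ h s) : s.Pairwise (fun a b => χ a h b = 1) := by
  have : Trans (fun a b => χ a h b = 1) (fun a b => χ a h b = 1) (fun a b => χ a h b = 1) :=
    ⟨hh.radial_trans hχ⟩
  exact List.isChain_iff_pairwise.1 hs.2.2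

/-- `RadialBefore χ x o a b`: in the counterclockwise sweep around `x` starting at `o`,
the element `a` precedes `b`. -/
def RadialBefore (χ : V → V → V → ℤ) (x o a b : V) : Prop :=
  (a = o ∧ (χ o x b = 1 ∨ χ o x b = -1)) ∨ (χ o x a = 1 ∧ χ o x b = -1) ∨
  (χ o x a = χ o x b ∧ (χ o x a = 1 ∨ χ o x a = -1) ∧ χ a x b = 1)

theorem RadialBefore.trans (hχ : IsOrderType χ) {x o a b c : V}
    (hab : RadialBefore χ x o a b) (hbc : RadialBefore χ x o b c) : RadialBefore χ x o a c := by
  have ho : χ o x o = 0 := hχ.2.1 o x o (by simp)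
  have key := fun ε hε ha hb hc => hχ.radial_trans (x := x) (p := o) (a := a) (b := b) (c := c)
    (ε := ε) hε ha hb hc
  unfold RadialBefore at *
  grind

theorem IsInternalSurroundSeq.exists_pairwise (hχ : IsOrderType χ) {x : V} {s : List V}
    (hs : IsInternalSurroundSeq χ x s) : ∃ o, o ≠ x ∧ s.Pairwise (RadialBefore χ x o) := by
  obtain ⟨-, hmem, hchain, -, p, ⟨hp0, hps, hpos, hneg⟩, -⟩ := hs
  have hlen : 0 < s.length := by omega
  have hget : ∀ j (hj : j < s.length), s.getD j x = s[j] := fun j hj => by simp [hj]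
  refine ⟨s[0], (hmem _).1 (List.getElem_mem _), ?_⟩
  have : Trans (RadialBefore χ x s[0]) (RadialBefore χ x s[0]) (RadialBefore χ x s[0]) :=
    ⟨RadialBefore.trans hχ⟩
  refine List.isChain_iff_pairwise.1 (List.isChain_iff_getElem.2 fun i hi => ?_)
  have step := List.isChain_iff_getElem.1 hchain i hi
  have sign : ∀ j (hj : j < s.length), 0 < j →
      (j ≤ p ∧ χ s[0] x s[j] = 1) ∨ (p < j ∧ χ s[0] x s[j] = -1) := fun j hj hj0 => by
    rw [← hget 0 hlen, ← hget j hj]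
    rcases le_or_gt j p with hjp | hjp
    · exact Or.inl ⟨hjp, hpos j hj0 hjp⟩
    · exact Or.inr ⟨hjp, hneg j hjp hj⟩
  have sign' := sign (i + 1) hi (by omega)
  unfold RadialBefore
  rcases Nat.eq_zero_or_pos i with rfl | hi0
  · exact Or.inl ⟨rfl, sign'.imp And.right And.right⟩
  · have sign'' := sign i (by omega) hi0
    right
    grind

/-- If `a` and `b` both lie clockwise of `h` around `x` and occur in this cyclic order after `h`
in the sweep starting at `o`, then `b` is counterclockwise of `a`. -/
theorem IsOrderType.radial_eq_one_of_cyclic (hχ : IsOrderType χ) {x o h a b : V}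
    (ox : o ≠ x) (hx : h ≠ x) (ab : a ≠ b) (ha : χ h x a = -1) (hb : χ h x b = -1)
    (hcyc : (RadialBefore χ x o h a ∧ RadialBefore χ x o a b) ∨
      (RadialBefore χ x o b h ∧ RadialBefore χ x o h a) ∨
      (RadialBefore χ x o a b ∧ RadialBefore χ x o b h)) : χ a x b = 1 := by
  have zero := hχ.2.1
  have ax : a ≠ x := by grind
  have bx : b ≠ x := by grind
  have ha' : a ≠ h := by grind
  have hb' : b ≠ h := by grind
  rcases hχ.1 a x b ax ab bx.symm with hab | hab
  · exact hab
  exfalso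
  have oo := zero o x o (by simp)
  have oh := hχ.swap_outer o x h
  have oa := hχ.swap_outer o x a
  have ob := hχ.swap_outer o x b
  have sa := hχ.swap_outer h x a
  have sb := hχ.swap_outer h x b
  by_cases h1 : o = h
  · subst h1
    unfold RadialBefore at hcyc
    grind
  by_cases h2 : o = a
  · subst h2
    unfold RadialBefore at hcyc
    grind
  by_cases h3 : o = b
  · subst h3
    unfold RadialBefore at hcyc
    grind
  have gp := hχ.radial_gp (x := x) (a := o) (b := h) (c := a) (d := b)
    ox.symm hx.symm ax.symm bx.symm h1 h2 h3 ha'.symm hb'.symm ab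
  rw [ha, hb, hab] at gp
  unfold RadialBefore at hcyc
  grind

theorem IsInternalSurroundSeq.radial_eq_one_of_sublist_rotate (hχ : IsOrderType χ)
    {x h a b : V} {s : List V} (hs : IsInternalSurroundSeq χ x s) {k : ℕ}
    (hhead : (s.rotate k).head? = some h) (ha : χ h x a = -1) (hb : χ h x b = -1)
    (hab : [a, b].Sublist (s.rotate k)) : χ a x b = 1 := by
  obtain ⟨o, ox, hpw⟩ := hs.exists_pairwise hχ
  have hx : h ≠ x := (hs.2.1 h).1 (List.mem_rotate.1 (List.mem_of_mem_head? hhead))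
  have ab : a ≠ b := by
    have := hab.nodup (List.nodup_rotate.2 hs.1)
    simpa using this
  have hpw' : ((s.rotate k).tail).Pairwise fun a b =>
      (RadialBefore χ x o h a ∧ RadialBefore χ x o a b) ∨
      (RadialBefore χ x o b h ∧ RadialBefore χ x o h a) ∨
      (RadialBefore χ x o a b ∧ RadialBefore χ x o b h) := by
    rw [List.rotate_eq_drop_append_take_mod] at hhead ⊢
    rw [← List.take_append_drop (k % s.length) s] at hpw
    generalize s.take (k % s.length) = A at *
    generalize hB : s.drop (k % s.length) = B at *
    cases B with
    | nil =>
      exfalso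
      have : 0 < s.length := by
        rw [List.length_pos_iff]
        rintro rfl
        have := hs.2.2.2.2.exists
        simp at this
      have := Nat.mod_lt k this
      have := List.drop_eq_nil_iff.1 hB
      omega
    | cons y B =>
      obtain rfl : y = h := by simpa using hhead
      simp only [List.pairwise_append, List.pairwise_cons, List.mem_cons, List.cons_append,
        List.tail_cons] at hpw ⊢
      obtain ⟨hA, ⟨hyB, hBB⟩, hAB⟩ := hpw
      refine ⟨?_, ?_, fun c hc d hd => Or.inr (Or.inl ⟨hAB d hd y (by simp), hyB c hc⟩)⟩
      · exact hBB.imp_of_mem fun hc _ hcd => Or.inl ⟨hyB _ hc, hcd⟩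
      · exact hA.imp_of_mem fun _ hd hcd => Or.inr (Or.inr ⟨hcd, hAB _ hd y (by simp)⟩)
  have hah : h ≠ a := by
    rintro rfl
    have := hχ.2.1 h x h (by simp)
    omega
  have hab' : [a, b].Sublist (s.rotate k).tail := by
    rw [← List.cons_head?_tail hhead] at hab
    exact hab.of_cons_of_ne hah.symm
  refine hχ.radial_eq_one_of_cyclic ox hx ab ha hb ?_
  simpa using hpw'.sublist hab'

theorem List.pair_sublist_or_swap {α : Type*} {a b : α} {l : List α} (hab : a ≠ b)
    (ha : a ∈ l) (hb : b ∈ l) : [a, b].Sublist l ∨ [b, a].Sublist l := by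
  induction l with
  | nil => simp at ha
  | cons c l ih =>
    rcases List.mem_cons.1 ha with rfl | ha'
    · left
      simpa [hab.symm] using hb
    · rcases List.mem_cons.1 hb with rfl | hb'
      · right
        simpa using ha'
      · exact (ih ha' hb').imp (·.cons c) (·.cons c)

end OrderTypeRadial

theorem chi_internal_neg_iff_before {V : Type*} [Fintype V] [DecidableEq V]
    (χ : V → V → V → ℤ) (hn : 4 ≤ Fintype.card V) (hχ : IsOrderType χ)
    (u v w : V) (huv : u ≠ v) (huw : u ≠ w) (hvw : v ≠ w)
    (hu : ¬IsHullElement χ u) (hv : ¬IsHullElement χ v) (hw : ¬IsHullElement χ w)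
    (hxor : ∀ h' : V, IsHullElement χ h' → ∀ s' : List V,
      IsHullSurroundSeq χ h' s' → Xor' ([u, v].Sublist s') ([w, v].Sublist s'))
    (h : V) (hh : IsHullElement χ h)
    (sh : List V) (hsh : IsHullSurroundSeq χ h sh)
    (huvb : [u, v].Sublist sh) (hvwb : [v, w].Sublist sh)
    (s ws : List V) (hint : IsInternalSurroundSeq χ u s)
    (k : ℕ) (hrot : ws = s.rotate k) (hhead : ws.head? = some h) :
    χ u v w = -1 ↔ [v, w].Sublist ws := by
  subst hrot
  have hpw := hsh.pairwise hχ hh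
  have uhv : χ u h v = 1 := by simpa using hpw.sublist huvb
  have vhw : χ v h w = 1 := by simpa using hpw.sublist hvwb
  have uhw : χ u h w = 1 := hh.radial_trans hχ uhv vhw
  have huv' : χ h u v = -1 := by rw [hχ.2.2.1 u h v, uhv]
  have huw' : χ h u w = -1 := by rw [hχ.2.2.1 u h w, uhw]
  rw [hχ.2.2.1 v u w, neg_inj]
  refine ⟨fun hvw1 => ?_, hint.radial_eq_one_of_sublist_rotate hχ hhead huv' huw'⟩
  refine (List.pair_sublist_or_swap hvw (List.mem_rotate.2 ((hint.2.1 v).2 huv.symm))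
    (List.mem_rotate.2 ((hint.2.1 w).2 huw.symm))).resolve_right fun hwv => ?_
  have := hint.radial_eq_one_of_sublist_rotate hχ hhead huw' huv' hwv
  have := hχ.swap_outer v u w
  omega
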